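/- arXiv:1804.08040 — 11 statements merged into one kernel-verified Lean document; each statement's English description precedes it below -/
import Mathlib

section
/- Let F be an element of T_o, i.e., a right-continuous, non-decreasing function F : ℝ → [0,∞] ∪ {−∞} with F(ν) = −∞ for all ν < 0 and F(ν) ≥ 0 for all ν ≥ 0. Then the lower pseudo-inverse F^↓ belongs to F_o: F^↓ is non-decreasing and left-continuous and F^↓(t) = 0 for all t ≤ 0. -/
open Set

/-- Upper pseudo-inverse: `F^↑(y) = sup {x | F x ≤ y}` (as an extended real,
with `sSup ∅ = ⊥`). -/
noncomputable def upInv (F : ℝ → EReal) (y : ℝ) : EReal :=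
  sSup (Real.toEReal '' {x : ℝ | F x ≤ (y : EReal)})

/-- Lower pseudo-inverse: `F^↓(y) = inf {x | F x ≥ y}` (as an extended real,
with `sInf ∅ = ⊤`). -/
noncomputable def loInv (F : ℝ → EReal) (y : ℝ) : EReal :=
  sInf (Real.toEReal '' {x : ℝ | (y : EReal) ≤ F x})

/-- `F ∈ F_o`: non-decreasing, left-continuous, valued in `[0,∞]`, and `F t = 0` for `t ≤ 0`. -/
def MemFo (F : ℝ → EReal) : Prop :=
  Monotone F ∧ (∀ x : ℝ, ContinuousWithinAt F (Iic x) x) ∧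
    (∀ x : ℝ, 0 ≤ F x) ∧ (∀ x : ℝ, x ≤ 0 → F x = 0)

/-- `F ∈ T_o`: non-decreasing, right-continuous, `F ν = −∞` for `ν < 0`,
`F ν ≥ 0` for `ν ≥ 0`. -/
def MemTo (F : ℝ → EReal) : Prop :=
  Monotone F ∧ (∀ x : ℝ, ContinuousWithinAt F (Ici x) x) ∧
    (∀ x : ℝ, x < 0 → F x = ⊥) ∧ (∀ x : ℝ, 0 ≤ x → 0 ≤ F x)

/-- Min-plus convolution `F ⊗ G (t) = inf_{0 ≤ s ≤ t} (F s + G (t−s))`. -/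
noncomputable def minConv (F G : ℝ → EReal) (t : ℝ) : EReal :=
  sInf ((fun s => F s + G (t - s)) '' Icc 0 t)

/-- Max-plus convolution `F ⊗̄ G (ν) = sup_{0 ≤ κ ≤ ν} (F κ + G (ν−κ))`. -/
noncomputable def maxConv (F G : ℝ → EReal) (ν : ℝ) : EReal :=
  sSup ((fun κ => F κ + G (ν - κ)) '' Icc 0 ν)

theorem loInv_mono (F : ℝ → EReal) : Monotone (loInv F) := fun _ _ hab =>
  sInf_le_sInf (image_mono fun _ hx => (EReal.coe_le_coe_iff.2 hab).trans hx)

/-- For monotone `F`, every point where `F` is below `t` is a lower bound of `F^↓ t`. -/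
theorem coe_le_loInv {F : ℝ → EReal} (hF : Monotone F) {q t : ℝ} (h : F q < t) :
    (q : EReal) ≤ loInv F t := by
  refine le_sInf ?_
  rintro _ ⟨x, hx, rfl⟩
  exact EReal.coe_le_coe_iff.2 (hF.reflect_lt (h.trans_le hx)).le

theorem lt_of_coe_lt_loInv {F : ℝ → EReal} {q t : ℝ} (h : (q : EReal) < loInv F t) :
    F q < t := by
  by_contra! hq
  exact h.not_ge (sInf_le ⟨q, hq, rfl⟩)

/-- The lower pseudo-inverse of a monotone function is left-continuous. -/
theorem continuousWithinAt_loInv {F : ℝ → EReal} (hF : Monotone F) (x : ℝ) :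
    ContinuousWithinAt (loInv F) (Iic x) x := by
  refine tendsto_order.2 ⟨fun c hc => ?_, fun c hc => ?_⟩
  · obtain ⟨q, hcq, hq⟩ := EReal.lt_iff_exists_real_btwn.1 hc
    obtain ⟨y, hFy, hyx⟩ := EReal.lt_iff_exists_real_btwn.1 (lt_of_coe_lt_loInv hq)
    filter_upwards [mem_nhdsWithin_of_mem_nhds (Ioi_mem_nhds (EReal.coe_lt_coe_iff.1 hyx))]
      with t ht
    exact hcq.trans_le (coe_le_loInv hF (hFy.trans (EReal.coe_lt_coe_iff.2 ht)))
  · filter_upwards [self_mem_nhdsWithin] with t ht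
    exact (loInv_mono F ht).trans_lt hc

/-- If `F ∈ T_o`, then its lower pseudo-inverse `F^↓` belongs to `F_o`. -/
theorem loInv_mem_Fo (F : ℝ → EReal) (hF : MemTo F) : MemFo (loInv F) := by
  obtain ⟨hmono, -, hneg, hpos⟩ := hF
  have hnonneg : ∀ x : ℝ, 0 ≤ loInv F x := by
    intro x
    refine le_sInf ?_
    rintro _ ⟨z, hz, rfl⟩
    by_contra! h
    rw [mem_ofPred_eq, hneg z (EReal.coe_neg'.1 h)] at hz
    exact EReal.coe_ne_bot x (le_bot_iff.1 hz)
  refine ⟨loInv_mono F, continuousWithinAt_loInv hmono, hnonneg, fun x hx => ?_⟩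
  refine le_antisymm (sInf_le ⟨0, ?_, EReal.coe_zero⟩) (hnonneg x)
  exact (EReal.coe_nonpos.2 hx).trans (hpos 0 le_rfl)
end

section
/- Let F : ℝ → [0,∞] be non-decreasing and left-continuous with F(t) = 0 for all t ≤ 0. Then (F^↑)^↓ = F, i.e., the lower pseudo-inverse of the upper pseudo-inverse of F recovers F. -/
open Set

/-- For a non-decreasing, left-continuous `F`, the upper pseudo-inverse and `F` satisfy
the Galois-type relation `t ≤ F^↑(y) ↔ F t ≤ y`. -/
theorem coe_le_upInv_iff {F : ℝ → EReal} (hmono : Monotone F) {t : ℝ}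
    (hlc : ContinuousWithinAt F (Iic t) t) {y : ℝ} :
    (t : EReal) ≤ upInv F y ↔ F t ≤ y := by
  refine ⟨fun h => ?_, fun h => le_sSup (mem_image_of_mem _ h)⟩
  refine le_of_tendsto (hlc.mono Iio_subset_Iic_self) ?_
  filter_upwards [self_mem_nhdsWithin] with s hs
  obtain ⟨_, ⟨x, hx, rfl⟩, hsx⟩ := lt_sSup_iff.1 ((EReal.coe_lt_coe_iff.2 hs).trans_le h)
  exact (hmono (EReal.coe_lt_coe_iff.1 hsx).le).trans hx

theorem sInf_image_coe_setOf_le (a : EReal) :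
    sInf (Real.toEReal '' {y : ℝ | a ≤ y}) = a := by
  refine le_antisymm (le_of_forall_gt fun c hc => ?_) (le_sInf ?_)
  · obtain ⟨y, hay, hyc⟩ := EReal.lt_iff_exists_real_btwn.1 hc
    exact (sInf_le (mem_image_of_mem Real.toEReal (show y ∈ {y : ℝ | a ≤ y} from hay.le))).trans_lt hyc
  · rintro _ ⟨y, hy, rfl⟩
    exact hy

/-- For a non-decreasing, left-continuous `F : ℝ → [0,∞]` with `F t = 0`
for `t ≤ 0`, the lower pseudo-inverse of the upper pseudo-inverse recovers `F`. -/
theorem loInv_upInv (F : ℝ → EReal) (hmono : Monotone F)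
    (hlc : ∀ x : ℝ, ContinuousWithinAt F (Iic x) x)
    (hnonneg : ∀ x : ℝ, 0 ≤ F x) (hzero : ∀ x : ℝ, x ≤ 0 → F x = 0) :
    loInv (upInv F) = F := by
  funext t
  simp only [loInv, coe_le_upInv_iff hmono (hlc t), sInf_image_coe_setOf_le]
end

section
/- Let F : ℝ → [0,∞] ∪ {−∞} be non-decreasing and right-continuous with F(ν) = −∞ for all ν < 0 and F(ν) ≥ 0 for all ν ≥ 0. Then (F^↓)^↑ = F, i.e., the upper pseudo-inverse of the lower pseudo-inverse of F recovers F. -/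
open Set

/-- A non-decreasing right-continuous function and its lower pseudo-inverse form a Galois
connection. -/
theorem loInv_le_coe_iff {F : ℝ → EReal} (hmono : Monotone F)
    (hrc : ∀ x : ℝ, ContinuousWithinAt F (Ici x) x) (y x : ℝ) :
    loInv F y ≤ (x : EReal) ↔ (y : EReal) ≤ F x := by
  refine ⟨fun h => ?_, fun h => sInf_le (mem_image_of_mem _ h)⟩
  refine ge_of_tendsto ((hrc x).mono Ioi_subset_Ici_self) ?_
  filter_upwards [self_mem_nhdsWithin] with z hz
  obtain ⟨_, ⟨w, hw, rfl⟩, hwz⟩ := sInf_lt_iff.mp (h.trans_lt (EReal.coe_lt_coe_iff.mpr hz))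
  exact le_trans hw (hmono (EReal.coe_lt_coe_iff.mp hwz).le)

/-- An extended real is the supremum of the reals below it. -/
theorem sSup_coe_image_setOf_coe_le (a : EReal) :
    sSup (Real.toEReal '' {t : ℝ | (t : EReal) ≤ a}) = a := by
  refine le_antisymm (sSup_le (forall_mem_image.mpr fun _ ht => ht)) (le_of_forall_lt fun b hb => ?_)
  obtain ⟨t, hbt, hta⟩ := EReal.lt_iff_exists_real_btwn.mp hb
  exact hbt.trans_le (le_sSup (mem_image_of_mem _ hta.le))

/-- For a non-decreasing, right-continuous `F : ℝ → [0,∞] ∪ {−∞}` with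
`F ν = −∞` for `ν < 0` and `F ν ≥ 0` for `ν ≥ 0`, the upper pseudo-inverse of the
lower pseudo-inverse recovers `F`. -/
theorem upInv_loInv (F : ℝ → EReal) (hmono : Monotone F)
    (hrc : ∀ x : ℝ, ContinuousWithinAt F (Ici x) x)
    (hneg : ∀ x : ℝ, x < 0 → F x = ⊥) (hnonneg : ∀ x : ℝ, 0 ≤ x → 0 ≤ F x) :
    upInv (loInv F) = F := by
  funext x
  simp only [upInv, loInv_le_coe_iff hmono hrc, sSup_coe_image_setOf_coe_le]
end

section
/- Let F and G be elements of F_o. Then for every ν ∈ ℝ, the upper pseudo-inverse of the pointwise minimum satisfies (F ∧ G)^↑(ν) = max{F^↑(ν), G^↑(ν)}. -/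
open Set

/-- For `F, G ∈ F_o`, `(F ∧ G)^↑(ν) = max {F^↑(ν), G^↑(ν)}` for every `ν`. -/
theorem upInv_min (F G : ℝ → EReal) (hF : MemFo F) (hG : MemFo G) :
    ∀ ν : ℝ, upInv (fun t => min (F t) (G t)) ν = max (upInv F ν) (upInv G ν) := by
  intro ν
  have h : {x : ℝ | min (F x) (G x) ≤ (ν : EReal)} = {x | F x ≤ ν} ∪ {x | G x ≤ ν} := by
    ext x
    simp only [mem_ofPred_eq, mem_union, min_le_iff]
  simp only [upInv, h, image_union, sSup_union]
end

section
/- Let F and G be elements of F_o. Then for every ν ∈ ℝ, the upper pseudo-inverse of the min-plus convolution equals the max-plus convolution of the upper pseudo-inverses: (F ⊗ G)^↑(ν) = F^↑ ⊗̄ G^↑(ν). -/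
open Set

theorem Monotone.lowerSemicontinuous_of_continuousWithinAt_Iic {F : ℝ → EReal} (hF : Monotone F)
    (hc : ∀ x : ℝ, ContinuousWithinAt F (Iic x) x) : LowerSemicontinuous F := by
  intro x y hy
  rw [← nhdsLE_sup_nhdsGE x, Filter.eventually_sup]
  refine ⟨(hc x).eventually (lt_mem_nhds hy), ?_⟩
  filter_upwards [self_mem_nhdsWithin] with z hz
  exact hy.trans_le (hF hz)

theorem minConv_of_neg (F G : ℝ → EReal) {t : ℝ} (ht : t < 0) : minConv F G t = ⊤ := by
  simp [minConv, Icc_eq_empty_of_lt ht]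

theorem le_upInv {F : ℝ → EReal} {x y : ℝ} (h : F x ≤ (y : EReal)) : (x : EReal) ≤ upInv F y :=
  le_sSup (mem_image_of_mem _ h)

theorem exists_nonneg_of_lt_upInv {F : ℝ → EReal} (hF : ∀ x : ℝ, x ≤ 0 → F x = 0) {y : ℝ}
    (hy : 0 ≤ y) {a : EReal} (ha : a < upInv F y) :
    ∃ x : ℝ, 0 ≤ x ∧ F x ≤ (y : EReal) ∧ a ≤ (x : EReal) := by
  obtain ⟨_, ⟨x, hx, rfl⟩, hax⟩ := lt_sSup_iff.1 ha
  rcases le_total 0 x with h | h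
  · exact ⟨x, h, hx, hax.le⟩
  · exact ⟨0, le_rfl, by rw [hF 0 le_rfl]; exact_mod_cast hy,
      hax.le.trans (by exact_mod_cast h)⟩

/-- The infimum defining `minConv F G t` is attained when `0 ≤ t`. -/
theorem exists_minConv_eq {F G : ℝ → EReal} (hF : MemFo F) (hG : MemFo G) {t : ℝ} (ht : 0 ≤ t) :
    ∃ s ∈ Icc 0 t, minConv F G t = F s + G (t - s) := by
  obtain ⟨hFm, hFc, hF0, -⟩ := hF
  obtain ⟨hGm, hGc, hG0, -⟩ := hG
  have hlsc : LowerSemicontinuous fun s => F s + G (t - s) := by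
    refine (hFm.lowerSemicontinuous_of_continuousWithinAt_Iic hFc).add'
      ((hGm.lowerSemicontinuous_of_continuousWithinAt_Iic hGc).comp
        (continuous_const.sub continuous_id)) fun s => ?_
    exact EReal.continuousAt_add
      (Or.inr (ne_of_gt (EReal.bot_lt_zero.trans_le (hG0 _))))
      (Or.inl (ne_of_gt (EReal.bot_lt_zero.trans_le (hF0 _))))
  obtain ⟨s, hs, hmin⟩ := (hlsc.lowerSemicontinuousOn (Icc 0 t)).exists_isMinOn
    (nonempty_Icc.2 ht) isCompact_Icc
  refine ⟨s, hs, le_antisymm (sInf_le ⟨s, hs, rfl⟩) (le_sInf ?_)⟩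
  rintro _ ⟨r, hr, rfl⟩
  exact hmin hr

/-- For `F, G ∈ F_o`, `(F ⊗ G)^↑(ν) = F^↑ ⊗̄ G^↑ (ν)` for every `ν`. -/
theorem upInv_minConv (F G : ℝ → EReal) (hF : MemFo F) (hG : MemFo G) :
    ∀ ν : ℝ, upInv (minConv F G) ν = maxConv (upInv F) (upInv G) ν := by
  intro ν
  apply le_antisymm
  · refine sSup_le ?_
    rintro _ ⟨t, ht, rfl⟩
    have ht' : minConv F G t ≤ (ν : EReal) := ht
    have ht0 : 0 ≤ t := by
      by_contra! h
      rw [minConv_of_neg F G h] at ht'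
      exact EReal.coe_ne_top ν (top_le_iff.1 ht')
    obtain ⟨s, hs, hst⟩ := exists_minConv_eq hF hG ht0
    rw [hst] at ht'
    have hF0 : 0 ≤ F s := hF.2.2.1 s
    have hG0 : 0 ≤ G (t - s) := hG.2.2.1 (t - s)
    have hFν : F s ≤ (ν : EReal) := (le_add_of_nonneg_right hG0).trans ht'
    have hGν : G (t - s) ≤ (ν : EReal) := (le_add_of_nonneg_left hF0).trans ht'
    obtain ⟨κ, hκ⟩ : ∃ κ : ℝ, (κ : EReal) = F s :=
      ⟨_, EReal.coe_toReal (ne_top_of_le_ne_top (EReal.coe_ne_top ν) hFν)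
        (ne_of_gt (EReal.bot_lt_zero.trans_le hF0))⟩
    obtain ⟨μ, hμ⟩ : ∃ μ : ℝ, (μ : EReal) = G (t - s) :=
      ⟨_, EReal.coe_toReal (ne_top_of_le_ne_top (EReal.coe_ne_top ν) hGν)
        (ne_of_gt (EReal.bot_lt_zero.trans_le hG0))⟩
    have hsum : κ + μ ≤ ν := by
      rw [← hκ, ← hμ] at ht'
      exact_mod_cast ht'
    have hκ0 : 0 ≤ κ := by
      rw [← hκ] at hF0
      exact_mod_cast hF0
    have hκν : κ ≤ ν := by
      rw [← hκ] at hFν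
      exact_mod_cast hFν
    have hμν : G (t - s) ≤ ((ν - κ : ℝ) : EReal) := by
      rw [← hμ]
      exact_mod_cast le_sub_iff_add_le'.2 hsum
    calc (t : EReal) = (s : EReal) + ((t - s : ℝ) : EReal) := by
          rw [← EReal.coe_add, add_sub_cancel]
      _ ≤ upInv F κ + upInv G (ν - κ) := add_le_add (le_upInv hκ.ge) (le_upInv hμν)
      _ ≤ maxConv (upInv F) (upInv G) ν := le_sSup ⟨κ, ⟨hκ0, hκν⟩, rfl⟩
  · refine sSup_le ?_
    rintro _ ⟨κ, ⟨hκ0, hκν⟩, rfl⟩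
    refine EReal.add_le_of_forall_lt fun a ha b hb => ?_
    obtain ⟨x, hx0, hx, hax⟩ := exists_nonneg_of_lt_upInv hF.2.2.2 hκ0 ha
    obtain ⟨y, hy0, hy, hby⟩ := exists_nonneg_of_lt_upInv hG.2.2.2 (sub_nonneg.2 hκν) hb
    calc a + b ≤ (x : EReal) + (y : EReal) := add_le_add hax hby
      _ = ((x + y : ℝ) : EReal) := (EReal.coe_add x y).symm
      _ ≤ upInv (minConv F G) ν := le_upInv ?_
    calc minConv F G (x + y) ≤ F x + G (x + y - x) :=
          sInf_le ⟨x, ⟨hx0, le_add_of_nonneg_right hy0⟩, rfl⟩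
      _ ≤ (κ : EReal) + ((ν - κ : ℝ) : EReal) := by
          rw [add_sub_cancel_left]
          exact add_le_add hx hy
      _ = (ν : EReal) := by rw [← EReal.coe_add, add_sub_cancel]
end

section
/- Let T_A, λ be elements of T_o and suppose that λ is a max-plus traffic envelope for T_A, i.e., T_A(ν) + λ(μ) ≤ T_A(ν+μ) for all ν, μ ≥ 0. Then λ^↓ is a min-plus traffic envelope for T_A^↓, i.e., T_A^↓(t+s) ≤ T_A^↓(t) + λ^↓(s) for all t, s ≥ 0. -/
open Set

theorem MemTo.nonneg_of_le {F : ℝ → EReal} (hF : MemTo F) {x y : ℝ}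
    (h : (y : EReal) ≤ F x) : 0 ≤ x := by
  by_contra! hx
  rw [hF.2.2.1 x hx] at h
  exact EReal.coe_ne_bot y (le_bot_iff.mp h)

theorem MemTo.loInv_nonneg {F : ℝ → EReal} (hF : MemTo F) (y : ℝ) : 0 ≤ loInv F y := by
  refine le_sInf ?_
  rintro _ ⟨x, hx, rfl⟩
  exact EReal.coe_nonneg.mpr (hF.nonneg_of_le hx)

theorem loInv_le {F : ℝ → EReal} {x y : ℝ} (h : (y : EReal) ≤ F x) : loInv F y ≤ x :=
  sInf_le ⟨x, h, rfl⟩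

theorem exists_lt_of_loInv_lt {F : ℝ → EReal} {y : ℝ} {a : EReal} (h : loInv F y < a) :
    ∃ x : ℝ, (y : EReal) ≤ F x ∧ (x : EReal) < a := by
  obtain ⟨_, ⟨x, hx, rfl⟩, hxa⟩ := sInf_lt_iff.mp h
  exact ⟨x, hx, hxa⟩

/-- If `T_A, λ ∈ T_o` and `λ` is a max-plus traffic envelope for `T_A`
(`T_A(ν) + λ(μ) ≤ T_A(ν+μ)` for `ν, μ ≥ 0`), then `λ^↓` is a min-plus traffic
envelope for `T_A^↓`: `T_A^↓(t+s) ≤ T_A^↓(t) + λ^↓(s)` for `t, s ≥ 0`. -/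
theorem envelope_to_minplus (TA lam : ℝ → EReal) (hTA : MemTo TA) (hlam : MemTo lam)
    (henv : ∀ ν : ℝ, 0 ≤ ν → ∀ μ : ℝ, 0 ≤ μ → TA ν + lam μ ≤ TA (ν + μ)) :
    ∀ t : ℝ, 0 ≤ t → ∀ s : ℝ, 0 ≤ s → loInv TA (t + s) ≤ loInv TA t + loInv lam s := by
  intro t _ s _
  have bot_ne {F : ℝ → EReal} (hF : MemTo F) (y : ℝ) : loInv F y ≠ ⊥ :=
    (EReal.bot_lt_zero.trans_le (hF.loInv_nonneg y)).ne'
  refine EReal.le_add_of_forall_gt (Or.inl (bot_ne hTA t)) (Or.inr (bot_ne hlam s)) ?_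
  intro a ha b hb
  obtain ⟨x, hx, hxa⟩ := exists_lt_of_loInv_lt ha
  obtain ⟨y, hy, hyb⟩ := exists_lt_of_loInv_lt hb
  have hxy : ((t + s : ℝ) : EReal) ≤ TA (x + y) := by
    rw [EReal.coe_add]
    exact (add_le_add hx hy).trans
      (henv x (hTA.nonneg_of_le hx) y (hlam.nonneg_of_le hy))
  refine (loInv_le hxy).trans ?_
  rw [EReal.coe_add]
  exact add_le_add hxa.le hyb.le
end

section
/- Let F and G be elements of T_o that are real-valued (finite) on [0,∞). Then for every ν ≥ 0 the supremum defining the max-plus convolution is attained: there exists μ ∈ [0, ν] such that F ⊗̄ G(ν) = F(μ) + G(ν−μ). -/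
open Set

/-- A monotone right-continuous function is upper semicontinuous. -/
theorem Monotone.upperSemicontinuous_of_continuousWithinAt_Ici {α β : Type*}
    [LinearOrder α] [TopologicalSpace α] [LinearOrder β] [TopologicalSpace β]
    [OrderTopology β] {f : α → β} (hf : Monotone f)
    (hc : ∀ x, ContinuousWithinAt f (Ici x) x) : UpperSemicontinuous f := by
  intro x y hy
  filter_upwards [eventually_nhdsWithin_iff.mp ((hc x).eventually_lt_const hy)] with z hz
  rcases le_total x z with h | h
  · exact hz h
  · exact (hf h).trans_lt hy

/-- For `F, G ∈ T_o` that are finite on `[0,∞)`, the supremum defining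
the max-plus convolution is attained: for every `ν ≥ 0` there is `μ ∈ [0, ν]` with
`F ⊗̄ G (ν) = F(μ) + G(ν−μ)`. -/
theorem maxConv_attained (F G : ℝ → EReal) (hF : MemTo F) (hG : MemTo G)
    (hFfin : ∀ ν : ℝ, 0 ≤ ν → F ν ≠ ⊤) (hGfin : ∀ ν : ℝ, 0 ≤ ν → G ν ≠ ⊤) :
    ∀ ν : ℝ, 0 ≤ ν → ∃ μ ∈ Icc (0 : ℝ) ν, maxConv F G ν = F μ + G (ν - μ) := by
  intro ν hν
  have hFu := hF.1.upperSemicontinuous_of_continuousWithinAt_Ici hF.2.1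
  have hGu := (hG.1.upperSemicontinuous_of_continuousWithinAt_Ici hG.2.1).comp
    (continuous_const.sub continuous_id : Continuous fun κ : ℝ => ν - κ)
  have hadd : UpperSemicontinuousOn (fun κ => F κ + G (ν - κ)) (Icc 0 ν) := by
    refine (hFu.upperSemicontinuousOn _).add' (hGu.upperSemicontinuousOn _) fun κ hκ => ?_
    have hκ' : 0 ≤ ν - κ := sub_nonneg.mpr hκ.2
    exact EReal.continuousAt_add (Or.inl (hFfin κ hκ.1)) (Or.inr (hGfin _ hκ'))
  obtain ⟨μ, hμ, hmax⟩ := hadd.exists_isMaxOn (nonempty_Icc.mpr hν) isCompact_Icc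
  refine ⟨μ, hμ, le_antisymm (sSup_le ?_) (le_sSup (mem_image_of_mem _ hμ))⟩
  rintro _ ⟨κ, hκ, rfl⟩
  exact hmax hκ
end

section
/- Let A and S be elements of F_o, let T_A = A^↑ be the associated arrival time function, and define the SCED deadline of bit ν as Dl(ν) = (A ⊗ S)^↑(ν). Then for every t ≥ 0, the total amount of arrivals in [0,t) with deadline less than t satisfies sup{ν : 0 ≤ T_A(ν) < t and Dl(ν) < t} = A ⊗ S(t), with the convention that the supremum over the empty set equals 0. (This is Lemma 2 of the paper: A^{<t}(t) = A ⊗ S(t).) -/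
open Set

open Filter Topology in
/-- A monotone left-continuous function is lower semicontinuous. -/
theorem MemFo.lowerSemicontinuous {F : ℝ → EReal} (hF : MemFo F) : LowerSemicontinuous F := by
  intro x c hc
  rw [← nhdsLE_sup_nhdsGE, eventually_sup]
  refine ⟨(hF.2.1 x).eventually (lt_mem_nhds hc), ?_⟩
  filter_upwards [self_mem_nhdsWithin] with y hy
  exact hc.trans_le (hF.1 hy)

theorem minConv_nonneg {A S : ℝ → EReal} (hA : MemFo A) (hS : MemFo S) (t : ℝ) :
    0 ≤ minConv A S t := by
  refine le_sInf ?_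
  rintro _ ⟨s, -, rfl⟩
  exact add_nonneg (hA.2.2.1 s) (hS.2.2.1 _)

theorem minConv_le_left {A S : ℝ → EReal} (hS : MemFo S) {t : ℝ} (ht : 0 ≤ t) :
    minConv A S t ≤ A t := by
  refine sInf_le ⟨t, ⟨ht, le_rfl⟩, ?_⟩
  simp [hS.2.2.2 0 le_rfl]

theorem minConv_mono {A S : ℝ → EReal} (hA : MemFo A) (hS : MemFo S) {x y : ℝ}
    (hx : 0 ≤ x) (hxy : x ≤ y) : minConv A S x ≤ minConv A S y := by
  refine le_sInf ?_
  rintro _ ⟨s, hs, rfl⟩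
  rcases le_total s x with hsx | hsx
  · have h : minConv A S x ≤ A s + S (x - s) := sInf_le ⟨s, ⟨hs.1, hsx⟩, rfl⟩
    exact h.trans (add_le_add le_rfl (hS.1 (sub_le_sub_right hxy s)))
  · exact ((minConv_le_left hS hx).trans (hA.1 hsx)).trans
      (le_add_of_nonneg_right (hS.2.2.1 _))

theorem lowerSemicontinuous_minConv_kernel {A S : ℝ → EReal} (hA : MemFo A) (hS : MemFo S) :
    LowerSemicontinuous (fun p : ℝ × ℝ => A p.2 + S (p.1 - p.2)) := by
  have h₁ : LowerSemicontinuous (fun p : ℝ × ℝ => A p.2) :=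
    hA.lowerSemicontinuous.comp continuous_snd
  have h₂ : LowerSemicontinuous (fun p : ℝ × ℝ => S (p.1 - p.2)) :=
    hS.lowerSemicontinuous.comp (continuous_fst.sub continuous_snd)
  refine h₁.add' h₂ fun p => EReal.continuousAt_add (Or.inr ?_) (Or.inl ?_)
  · exact (EReal.bot_lt_zero.trans_le (hS.2.2.1 _)).ne'
  · exact (EReal.bot_lt_zero.trans_le (hA.2.2.1 _)).ne'

open Filter Topology in
/-- The left-continuity of `A ⊗ S` on `(0, ∞)`, by compactness of `[0, t]`. -/
theorem exists_lt_minConv {A S : ℝ → EReal} (hA : MemFo A) (hS : MemFo S) {t : ℝ}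
    (ht : 0 < t) {c : EReal} (hc : c < minConv A S t) :
    ∃ y, 0 ≤ y ∧ y < t ∧ c < minConv A S y := by
  obtain ⟨d, hcd, hd⟩ := exists_between hc
  have h : ∀ᶠ y in 𝓝 t, ∀ s ∈ Icc 0 t, d < A s + S (y - s) := by
    refine isCompact_Icc.eventually_forall_of_forall_eventually fun s hs => ?_
    exact lowerSemicontinuous_minConv_kernel hA hS (t, s) d (hd.trans_le (sInf_le ⟨s, hs, rfl⟩))
  obtain ⟨y, ⟨hy, hy0⟩, hyt⟩ := (((h.and (lt_mem_nhds ht)).filter_mono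
    nhdsWithin_le_nhds).and (self_mem_nhdsWithin (s := Iio t))).exists
  refine ⟨y, hy0.le, hyt, hcd.trans_le (le_sInf ?_)⟩
  rintro _ ⟨s, hs, rfl⟩
  exact (hy s ⟨hs.1, hs.2.trans (le_of_lt hyt)⟩).le

theorem upInv_lt_of_forall {F : ℝ → EReal} {ν y t : ℝ} (hyt : y < t)
    (h : ∀ x, F x ≤ (ν : EReal) → x ≤ y) : upInv F ν < (t : EReal) := by
  refine lt_of_le_of_lt (sSup_le ?_) (EReal.coe_lt_coe_iff.2 hyt)
  rintro _ ⟨x, hx, rfl⟩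
  exact EReal.coe_le_coe_iff.2 (h x hx)

theorem lt_of_upInv_lt {F : ℝ → EReal} {ν t : ℝ} (h : upInv F ν < (t : EReal)) :
    (ν : EReal) < F t := by
  by_contra! hle
  exact h.not_ge (le_sSup ⟨t, hle, rfl⟩)

/-- Lemma 2 of the paper: with `T_A = A^↑` and SCED deadlines
`Dl(ν) = (A ⊗ S)^↑(ν)`, for every `t ≥ 0` the arrivals in `[0,t)` with deadline
less than `t` satisfy `A^{<t}(t) = A ⊗ S (t)` (supremum over the empty set is `0`). -/
theorem sced_arrivals_with_deadline (A S : ℝ → EReal) (hA : MemFo A) (hS : MemFo S) :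
    ∀ t : ℝ, 0 ≤ t →
      sSup (insert (0 : EReal)
          (Real.toEReal ''
            {ν : ℝ | 0 ≤ upInv A ν ∧ upInv A ν < (t : EReal) ∧
              upInv (minConv A S) ν < (t : EReal)})) = minConv A S t := by
  intro t ht
  apply le_antisymm
  · refine sSup_le ?_
    rintro _ (rfl | ⟨ν, ⟨-, -, hν⟩, rfl⟩)
    · exact minConv_nonneg hA hS t
    · exact (lt_of_upInv_lt hν).le
  · refine le_of_forall_lt_imp_le_of_dense fun c hc => ?_
    rcases lt_or_ge c 0 with hc0 | hc0
    · exact hc0.le.trans (le_sSup (mem_insert _ _))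
    lift c to ℝ using ⟨(hc.trans_le le_top).ne, (EReal.bot_lt_zero.trans_le hc0).ne'⟩
    have ht0 : 0 < t := by
      refine ht.lt_of_ne ?_
      rintro rfl
      have h0 := minConv_le_left (A := A) hS (le_refl (0 : ℝ))
      rw [hA.2.2.2 0 le_rfl] at h0
      exact absurd (hc.trans_le h0) hc0.not_gt
    obtain ⟨y, hy0, hyt, hy⟩ := exists_lt_minConv hA hS ht0 hc
    refine le_sSup (mem_insert_of_mem _ ⟨c, ⟨?_, ?_, ?_⟩, rfl⟩)
    · exact le_sSup ⟨0, (hA.2.2.2 0 le_rfl).trans_le hc0, rfl⟩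
    · refine upInv_lt_of_forall hyt fun x hx => ?_
      by_contra! hyx
      exact (hy.trans_le ((minConv_le_left hS hy0).trans (hA.1 hyx.le))).not_ge hx
    · refine upInv_lt_of_forall hyt fun x hx => ?_
      by_contra! hyx
      exact (hy.trans_le (minConv_mono hA hS hy0 hyx.le)).not_ge hx
end

section
/- Let A, E, S be elements of F_o with A real-valued (finite), and suppose that E is a traffic envelope for A, i.e., A(u+s) ≤ A(u) + E(s) for all u, s ≥ 0. Then for all 0 ≤ t* ≤ t, the arrivals with deadlines before t that arrive after time t* are bounded by A ⊗ S(t) − A(t*) ≤ E ⊗ S(t − t*). (This is the key inequality in the proof of Theorem 1 of the paper.) -/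
open Set

/-- key inequality in the proof of Theorem 1: if `E` is a traffic
envelope for the finite-valued `A ∈ F_o`, then for `0 ≤ t* ≤ t`,
`A ⊗ S (t) − A(t*) ≤ E ⊗ S (t − t*)`. -/
theorem sced_envelope_bound (A E S : ℝ → EReal)
    (hA : MemFo A) (hE : MemFo E) (hS : MemFo S)
    (hAfin : ∀ t : ℝ, A t ≠ ⊤)
    (henv : ∀ u : ℝ, 0 ≤ u → ∀ s : ℝ, 0 ≤ s → A (u + s) ≤ A u + E s) :
    ∀ tstar t : ℝ, 0 ≤ tstar → tstar ≤ t →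
      minConv A S t - A tstar ≤ minConv E S (t - tstar) := by
  rintro tstar t h0 -
  refine le_sInf ?_
  rintro _ ⟨s, ⟨hs0, hst⟩, rfl⟩
  refine EReal.sub_le_of_le_add ?_
  calc minConv A S t
      ≤ A (tstar + s) + S (t - (tstar + s)) :=
        sInf_le ⟨tstar + s, ⟨by linarith, by linarith⟩, rfl⟩
    _ ≤ (A tstar + E s) + S (t - (tstar + s)) := by
        gcongr
        exact henv tstar h0 s hs0
    _ = E s + S (t - tstar - s) + A tstar := by
        rw [sub_sub, add_assoc, add_comm]
end

section
/- (Lemma 3 of the paper.) Let T_A be an element of T_o that is real-valued (finite) on [0,∞), let R > 0, and let γ_S be the rate service curve γ_S(ν) = ν/R for ν ≥ 0 and γ_S(ν) = −∞ for ν < 0. Let 0 ≤ ν̲ < ν and suppose that T_A(κ) < T_A ⊗̄ γ_S(κ) for all κ ∈ (ν̲, ν]. Then T_A ⊗̄ γ_S(ν) = sup_{0 ≤ κ ≤ ν̲} {T_A(κ) + (ν − κ)/R}, i.e., the max-plus convolution can be computed by restricting the supremum to bit values up to ν̲. -/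
open Set

theorem Monotone.upperSemicontinuous_of_continuousWithinAt_Ici_s17 {F : ℝ → EReal}
    (hF : Monotone F) (hc : ∀ x, ContinuousWithinAt F (Ici x) x) :
    UpperSemicontinuous F := by
  intro x y hy
  have h : ∀ᶠ z in nhdsWithin x (Ioi x), F z < y :=
    ((hc x).mono Ioi_subset_Ici_self).eventually (eventually_lt_nhds hy)
  obtain ⟨z, hz, hxz⟩ := (h.and self_mem_nhdsWithin).exists
  filter_upwards [eventually_lt_nhds hxz] with w hw
  exact (hF hw.le).trans_lt hz

/-- The maximum over `[0, ν]` of the arrival times offset by the rate `R` is attained in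
`[0, νb]`, provided it is never attained at the right end point of `[0, κ]` for `κ ∈ (νb, ν]`. -/
theorem exists_isMaxOn_of_busy {f : ℝ → ℝ} {νb ν : ℝ} (hνb : 0 ≤ νb) (hlt : νb < ν)
    (hf : UpperSemicontinuousOn f (Icc 0 ν))
    (hbusy : ∀ κ, νb < κ → κ ≤ ν → ∃ s ∈ Icc 0 κ, f κ < f s) :
    ∃ κ ∈ Icc 0 νb, IsMaxOn f (Icc 0 ν) κ := by
  obtain ⟨κ, hκ, hmax⟩ := hf.exists_isMaxOn (nonempty_Icc.2 (hνb.trans hlt.le)) isCompact_Icc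
  refine ⟨κ, ⟨hκ.1, ?_⟩, hmax⟩
  by_contra! h
  obtain ⟨s, hs, hlt⟩ := hbusy κ h hκ.2
  exact (hmax ⟨hs.1, hs.2.trans hκ.2⟩).not_gt hlt

theorem maxConv_rate (F : ℝ → EReal) (R ν : ℝ) :
    maxConv F (fun x => if x < 0 then (⊥ : EReal) else ((x / R : ℝ) : EReal)) ν =
      sSup ((fun κ => F κ + (((ν - κ) / R : ℝ) : EReal)) '' Icc 0 ν) := by
  refine congrArg sSup (image_congr fun κ hκ => ?_)
  simp only [if_neg (not_lt.2 (sub_nonneg.2 hκ.2))]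

/-- Lemma 3 of the paper: for a rate service curve `γ_S(ν) = ν/R` and an
arrival time function `T_A ∈ T_o` finite on `[0,∞)`, if `T_A(κ) < T_A ⊗̄ γ_S(κ)` for all
`κ ∈ (ν̲, ν]`, then the convolution at `ν` can be restricted to `κ ∈ [0, ν̲]`. -/
theorem rate_deadline_busy_period (TA : ℝ → EReal) (hTA : MemTo TA)
    (hfin : ∀ ν : ℝ, 0 ≤ ν → TA ν ≠ ⊤) (R : ℝ) (hR : 0 < R)
    (νb ν : ℝ) (hνb : 0 ≤ νb) (hlt : νb < ν)
    (hstrict : ∀ κ : ℝ, νb < κ → κ ≤ ν →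
      TA κ < maxConv TA (fun x => if x < 0 then (⊥ : EReal) else ((x / R : ℝ) : EReal)) κ) :
    maxConv TA (fun x => if x < 0 then (⊥ : EReal) else ((x / R : ℝ) : EReal)) ν =
      sSup ((fun κ => TA κ + (((ν - κ) / R : ℝ) : EReal)) '' Icc 0 νb) := by
  obtain ⟨hmono, hcont, -, hnonneg⟩ := hTA
  have hcoe : ∀ κ, 0 ≤ κ → TA κ = ((TA κ).toReal : EReal) := fun κ hκ =>
    (EReal.coe_toReal (hfin κ hκ) (ne_bot_of_le_ne_bot EReal.zero_ne_bot (hnonneg κ hκ))).symm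
  have husc : UpperSemicontinuousOn (fun κ => (TA κ).toReal) (Icc 0 ν) := by
    intro κ hκ y hy
    have hy' : TA κ < (y : EReal) := by
      rw [hcoe κ hκ.1]
      exact EReal.coe_lt_coe_iff.2 hy
    filter_upwards [nhdsWithin_le_nhds
      (hmono.upperSemicontinuous_of_continuousWithinAt_Ici_s17 hcont κ y hy'),
      self_mem_nhdsWithin] with s hs hs'
    rw [hcoe s hs'.1] at hs
    exact EReal.coe_lt_coe_iff.1 hs
  have hoffset : UpperSemicontinuousOn (fun κ => (TA κ).toReal + -(κ / R)) (Icc 0 ν) :=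
    husc.add (Continuous.continuousOn (by fun_prop)).upperSemicontinuousOn
  obtain ⟨m, hm, hmax⟩ := exists_isMaxOn_of_busy hνb hlt hoffset fun κ hκ hκν => by
    have h := hstrict κ hκ hκν
    rw [maxConv_rate, lt_sSup_iff] at h
    obtain ⟨_, ⟨s, hs, rfl⟩, h⟩ := h
    refine ⟨s, hs, ?_⟩
    dsimp only at h ⊢
    rw [hcoe κ (hνb.trans hκ.le), hcoe s hs.1, ← EReal.coe_add, EReal.coe_lt_coe_iff,
      sub_div] at h
    linarith
  rw [maxConv_rate]
  refine le_antisymm (sSup_le ?_) (sSup_le_sSup (image_mono (Icc_subset_Icc_right hlt.le)))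
  rintro _ ⟨κ, hκ, rfl⟩
  refine le_sSup_of_le ⟨m, hm, rfl⟩ ?_
  have h : (TA κ).toReal + -(κ / R) ≤ (TA m).toReal + -(m / R) := hmax hκ
  dsimp only
  rw [hcoe κ hκ.1, hcoe m hm.1, ← EReal.coe_add, ← EReal.coe_add, EReal.coe_le_coe_iff,
    sub_div, sub_div]
  linarith
end

section
/- (SCED deadline for a single segment of a piecewise linear convex service curve.) Let T_A be an element of T_o, let r > 0 and e ≥ 0, and define γ(ν) = max{ν/r − e, 0} for ν ≥ 0 and γ(ν) = −∞ for ν < 0, as well as the rate service curve ρ(ν) = ν/r for ν ≥ 0 and ρ(ν) = −∞ for ν < 0. Then for every ν ≥ 0, T_A ⊗̄ γ(ν) = max{T_A ⊗̄ ρ(ν) − e, T_A(ν)}. -/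
open Set

theorem le_maxConv {F G : ℝ → EReal} {κ ν : ℝ} (hκ : κ ∈ Icc 0 ν) :
    F κ + G (ν - κ) ≤ maxConv F G ν :=
  le_sSup (mem_image_of_mem _ hκ)

theorem maxConv_le {F G : ℝ → EReal} {ν : ℝ} {a : EReal}
    (h : ∀ κ ∈ Icc 0 ν, F κ + G (ν - κ) ≤ a) : maxConv F G ν ≤ a :=
  sSup_le (forall_mem_image.2 h)

theorem ereal_add_coe_sub (a : EReal) (x e : ℝ) :
    a + ((x - e : ℝ) : EReal) = a + (x : EReal) - (e : EReal) := by
  rw [EReal.coe_sub, sub_eq_add_neg, sub_eq_add_neg, add_assoc]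

/-- SCED deadline for one segment `γ(ν) = [ν/r − e]^+` of a piecewise
linear convex service curve: `T_A ⊗̄ γ (ν) = max {T_A ⊗̄ ρ (ν) − e, T_A(ν)}`, where
`ρ(ν) = ν/r` is the rate service curve. -/
theorem convex_segment_deadline (TA : ℝ → EReal) (hTA : MemTo TA)
    (r e : ℝ) (hr : 0 < r) (he : 0 ≤ e) :
    ∀ ν : ℝ, 0 ≤ ν →
      maxConv TA (fun x => if x < 0 then (⊥ : EReal) else ((max (x / r - e) 0 : ℝ) : EReal)) ν =
        max (maxConv TA (fun x => if x < 0 then (⊥ : EReal) else ((x / r : ℝ) : EReal)) ν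
              - (e : EReal))
            (TA ν) := by
  intro ν hν
  apply le_antisymm
  · refine maxConv_le fun κ hκ => ?_
    have hlt : ¬ ν - κ < 0 := by linarith [hκ.2]
    simp only [if_neg hlt]
    rcases le_total ((ν - κ) / r - e) 0 with h | h
    · rw [max_eq_right h, EReal.coe_zero, add_zero]
      exact le_max_of_le_right (hTA.1 hκ.2)
    · rw [max_eq_left h, ereal_add_coe_sub]
      refine le_max_of_le_left (EReal.sub_le_sub ?_ le_rfl)
      simpa only [if_neg hlt] using le_maxConv (F := TA)
        (G := fun x => if x < 0 then (⊥ : EReal) else ((x / r : ℝ) : EReal)) hκ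
  · apply max_le
    · rw [EReal.sub_le_iff_le_add (Or.inl (EReal.coe_ne_bot e)) (Or.inl (EReal.coe_ne_top e))]
      refine maxConv_le fun κ hκ => ?_
      have hlt : ¬ ν - κ < 0 := by linarith [hκ.2]
      rw [← EReal.sub_le_iff_le_add (Or.inl (EReal.coe_ne_bot e)) (Or.inl (EReal.coe_ne_top e))]
      refine le_trans ?_ (le_maxConv hκ)
      simp only [if_neg hlt]
      rw [← ereal_add_coe_sub]
      exact add_le_add_right (EReal.coe_le_coe_iff.2 (le_max_left _ _)) _
    · refine le_trans ?_ (le_maxConv (right_mem_Icc.2 hν))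
      simp [he]
end
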